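/- Let Ψ ∈ ℝ^{n×n} be symmetric, P ∈ ℝ^{p×n}, Q ∈ ℝ^{q×n}. Let N_P ∈ ℝ^{n×r_P} and N_Q ∈ ℝ^{n×r_Q} be matrices whose columns form bases of the null spaces of P and Q respectively (i.e. N_P has linearly independent columns, P·N_P = 0, and the column span of N_P equals the null space of P; likewise for N_Q). Then there exists a matrix X ∈ ℝ^{q×p} such that Ψ + PᵀXᵀQ + QᵀXP is negative definite if and only if both N_PᵀΨN_P and N_QᵀΨN_Q are negative definite. -/

import Mathlib

open Matrix

/-- A real matrix is negative definite iff its negation is positive definite,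
i.e. it is symmetric and `xᵀ M x < 0` for every nonzero `x`. -/
def NegDef {n : Type*} [Fintype n] (M : Matrix n n ℝ) : Prop := (-M).PosDef

section Decomposition

variable {K V : Type*} [Field K] [AddCommGroup V] [Module K V]

/-- If `C` is a complement of `U ⊓ W` and `R` is a complement of `(U ⊓ C) ⊔ (W ⊓ C)` inside `C`,
then `(U ⊓ C) ⊔ R` is a complement of `W`. -/
theorem isCompl_sup_of_isCompl_inf {U W C R : Submodule K V} (hC : IsCompl (U ⊓ W) C)
    (hdisj : Disjoint (U ⊓ C ⊔ W ⊓ C) R) (hsup : U ⊓ C ⊔ W ⊓ C ⊔ R = C) :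
    IsCompl (U ⊓ C ⊔ R) W := by
  have hR : R ≤ C := le_sup_right.trans hsup.le
  constructor
  · rw [Submodule.disjoint_def]
    intro y hy hyW
    have hyC : y ∈ C := sup_le inf_le_right hR hy
    obtain ⟨u, hu, r, hr, rfl⟩ := Submodule.mem_sup.1 hy
    have hr0 : r = 0 := by
      refine Submodule.disjoint_def.1 hdisj r ?_ hr
      have := Submodule.sub_mem _ (Submodule.mem_sup_right (S := U ⊓ C)
        (Submodule.mem_inf.2 ⟨hyW, hyC⟩))
        (Submodule.mem_sup_left (T := W ⊓ C) hu)
      simpa using this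
    subst hr0
    rw [add_zero] at hyW ⊢
    exact Submodule.disjoint_def.1 hC.disjoint u ⟨hu.1, hyW⟩ hu.2
  · rw [codisjoint_iff, eq_top_iff, ← hC.sup_eq_top]
    refine sup_le (inf_le_right.trans le_sup_right) ?_
    calc C = U ⊓ C ⊔ W ⊓ C ⊔ R := hsup.symm
      _ ≤ U ⊓ C ⊔ R ⊔ W := sup_le (sup_le (le_sup_left.trans le_sup_left)
          (inf_le_left.trans le_sup_right)) (le_sup_right.trans le_sup_left)

/-- Compatible projections `a` along `W` and `b` along `U`, together with the resulting splitting
of every vector into components in `U ⊓ W`, `U ⊓ C`, `W ⊓ C` and `C`. -/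
theorem exists_compatible_projections {U W C : Submodule K V} (hC : IsCompl (U ⊓ W) C) :
    ∃ a b : V →ₗ[K] V, W ≤ LinearMap.ker a ∧ U ≤ LinearMap.ker b ∧
      ∀ x, ∃ k ∈ U ⊓ W, ∃ u ∈ U ⊓ C, ∃ w ∈ W ⊓ C, ∃ r ∈ C,
        x = k + u + w + r ∧ a x = u + r ∧ b x = w + r ∧ b (a x) = r ∧ a (b x) = r := by
  obtain ⟨R₀, hR₀⟩ := exists_isCompl (U ⊓ C ⊔ W ⊓ C)
  have hS : U ⊓ C ⊔ W ⊓ C ≤ C := sup_le inf_le_right inf_le_right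
  have hdisj : Disjoint (U ⊓ C ⊔ W ⊓ C) (R₀ ⊓ C) := hR₀.disjoint.mono_right inf_le_left
  have hsup : U ⊓ C ⊔ W ⊓ C ⊔ R₀ ⊓ C = C := by
    rw [← sup_inf_assoc_of_le _ hS, hR₀.sup_eq_top, top_inf_eq]
  have ha := isCompl_sup_of_isCompl_inf hC hdisj hsup
  have hb := isCompl_sup_of_isCompl_inf (U := W) (W := U) (C := C) (R := R₀ ⊓ C)
    (by rwa [inf_comm]) (by rwa [sup_comm]) (by rwa [sup_comm (W ⊓ C)])
  set a := Submodule.projection _ _ ha with ha_def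
  set b := Submodule.projection _ _ hb with hb_def
  have haW : ∀ x ∈ W, a x = 0 := fun x hx => (Submodule.projection_apply_eq_zero_iff ha).2 hx
  have hbU : ∀ x ∈ U, b x = 0 := fun x hx => (Submodule.projection_apply_eq_zero_iff hb).2 hx
  have haU : ∀ x ∈ U ⊓ C, a x = x := fun x hx =>
    Submodule.projection_apply_of_mem_left ha (Submodule.mem_sup_left hx)
  have hbW : ∀ x ∈ W ⊓ C, b x = x := fun x hx =>
    Submodule.projection_apply_of_mem_left hb (Submodule.mem_sup_left hx)
  have haR : ∀ x ∈ R₀ ⊓ C, a x = x := fun x hx =>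
    Submodule.projection_apply_of_mem_left ha (Submodule.mem_sup_right hx)
  have hbR : ∀ x ∈ R₀ ⊓ C, b x = x := fun x hx =>
    Submodule.projection_apply_of_mem_left hb (Submodule.mem_sup_right hx)
  refine ⟨a, b, haW, hbU, fun x => ?_⟩
  have hx : x ∈ U ⊓ W ⊔ (U ⊓ C ⊔ W ⊓ C ⊔ R₀ ⊓ C) := by
    rw [hsup, hC.sup_eq_top]; trivial
  obtain ⟨k, hk, c, hc, rfl⟩ := Submodule.mem_sup.1 hx
  obtain ⟨s, hs, r, hr, rfl⟩ := Submodule.mem_sup.1 hc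
  obtain ⟨u, hu, w, hw, rfl⟩ := Submodule.mem_sup.1 hs
  have hax : a (k + (u + w + r)) = u + r := by
    simp only [map_add, haW k hk.2, haU u hu, haW w hw.1, haR r hr, zero_add, add_zero]
  have hbx : b (k + (u + w + r)) = w + r := by
    simp only [map_add, hbU k hk.1, hbU u hu.1, hbW w hw, hbR r hr, zero_add]
  refine ⟨k, hk, u, hu, w, hw, r, hr.2, by abel, hax, hbx, ?_, ?_⟩
  · rw [hax, map_add, hbU u hu.1, hbR r hr, zero_add]
  · rw [hbx, map_add, haW w hw.1, haR r hr, zero_add]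

/-- A linear map has a generalized inverse through which every map vanishing on its kernel
factors. -/
theorem LinearMap.exists_generalizedInverse {V' : Type*} [AddCommGroup V'] [Module K V']
    (f : V →ₗ[K] V') :
    ∃ s : V' →ₗ[K] V, ∀ a : V →ₗ[K] V, LinearMap.ker f ≤ LinearMap.ker a →
      ∀ x, a (s (f x)) = a x := by
  obtain ⟨s₀, hs₀⟩ := f.rangeRestrict.exists_rightInverse_of_surjective f.range_rangeRestrict
  obtain ⟨s, hs⟩ := s₀.exists_extend
  refine ⟨s, fun a ha x => ?_⟩
  have hfs : f (s (f x)) = f x := by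
    have h₁ : s (f x) = s₀ (f.rangeRestrict x) := LinearMap.congr_fun hs (f.rangeRestrict x)
    have h₂ := congrArg Subtype.val (LinearMap.congr_fun hs₀ (f.rangeRestrict x))
    rw [h₁]
    exact h₂
  rw [← sub_eq_zero, ← map_sub]
  exact ha (by rw [LinearMap.mem_ker, map_sub, hfs, sub_self])

end Decomposition

/-- Coordinate-free form of the projection lemma: a symmetric form positive on `U` and on `W`
becomes positive after subtracting twice a form that vanishes for `W` on the left
and for `U` on the right. -/
theorem exists_form_sub_two_mul_pos {V : Type*} [AddCommGroup V] [Module ℝ V]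
    [FiniteDimensional ℝ V] (B D : LinearMap.BilinForm ℝ V) (hB : B.IsSymm)
    (hD : ∀ x, x ≠ 0 → 0 < D x x) (U W : Submodule ℝ V)
    (hU : ∀ x ∈ U, x ≠ 0 → 0 < B x x) (hW : ∀ x ∈ W, x ≠ 0 → 0 < B x x) :
    ∃ (a b : V →ₗ[ℝ] V) (G : LinearMap.BilinForm ℝ V),
      W ≤ LinearMap.ker a ∧ U ≤ LinearMap.ker b ∧
        ∀ x, x ≠ 0 → 0 < B x x - 2 * G (a x) (b x) := by
  have hC : IsCompl (U ⊓ W) (B.orthogonal (U ⊓ W)) := by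
    rw [LinearMap.BilinForm.isCompl_orthogonal_iff_disjoint hB.isRefl, Submodule.disjoint_def]
    intro x hx hx'
    by_contra h0
    exact (hU x hx.1 h0).ne' (LinearMap.BilinForm.mem_orthogonal_iff.1 hx' x hx)
  obtain ⟨a, b, ha, hb, hsplit⟩ := exists_compatible_projections hC
  refine ⟨a, b, B - (1 / 2 : ℝ) • (B + D).compl₁₂ b a, ha, hb, fun x hx0 => ?_⟩
  obtain ⟨k, hk, u, hu, w, hw, r, hr, hx, hax, hbx, hba, hab⟩ := hsplit x
  have orth : ∀ y ∈ B.orthogonal (U ⊓ W), B k y = 0 ∧ B y k = 0 := fun y hy => by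
    have h := LinearMap.BilinForm.mem_orthogonal_iff.1 hy k hk
    exact ⟨h, hB.isRefl _ _ h⟩
  have key : B x x - 2 * (B - (1 / 2 : ℝ) • (B + D).compl₁₂ b a) (a x) (b x)
      = B k k + B u u + B w w + D r r := by
    simp only [LinearMap.sub_apply, LinearMap.smul_apply, LinearMap.compl₁₂_apply,
      LinearMap.add_apply, smul_eq_mul, hba, hab]
    rw [hax, hbx, hx]
    simp only [map_add, LinearMap.add_apply, orth u hu.2, orth w hw.2, orth r hr]
    rw [hB.eq w u, hB.eq r u, hB.eq w r]
    ring
  rw [key]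
  have nonneg : ∀ {E : LinearMap.BilinForm ℝ V} {y : V}, (y ≠ 0 → 0 < E y y) → 0 ≤ E y y := by
    intro E y h
    by_cases hy : y = 0
    · simp [hy]
    · exact (h hy).le
  have hk' := hU k hk.1
  have hu' := hU u hu.1
  have hw' := hW w hw.1
  have hr' := hD r
  have hk₀ := nonneg hk'
  have hu₀ := nonneg hu'
  have hw₀ := nonneg hw'
  have hr₀ := nonneg hr'
  by_contra hneg
  have k0 : k = 0 := by by_contra h; linarith [hk' h]
  have u0 : u = 0 := by by_contra h; linarith [hu' h]
  have w0 : w = 0 := by by_contra h; linarith [hw' h]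
  have r0 : r = 0 := by by_contra h; linarith [hr' h]
  exact hx0 (by simp [hx, k0, u0, w0, r0])

theorem negDef_iff {m : Type*} [Fintype m] {M : Matrix m m ℝ} (hM : M.IsSymm) :
    NegDef M ↔ ∀ x : m → ℝ, x ≠ 0 → x ⬝ᵥ M *ᵥ x < 0 := by
  have hH : (-M).IsHermitian := by
    rw [Matrix.IsHermitian, Matrix.conjTranspose_eq_transpose_of_trivial, Matrix.transpose_neg,
      hM.eq]
  rw [NegDef, Matrix.posDef_iff_dotProduct_mulVec, and_iff_right hH]
  simp [Matrix.neg_mulVec]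

/-- The compression of `Ψ` to the null space of `P`, in terms of a basis `N` of that null space,
is negative definite iff `Ψ` is negative on the null space. -/
theorem negDef_compression_iff {n p r : Type*} [Fintype n] [Fintype r]
    {Ψ : Matrix n n ℝ} (hΨ : Ψ.IsSymm) {P : Matrix p n ℝ} {N : Matrix n r ℝ}
    (hli : LinearIndependent ℝ (fun j => Nᵀ j))
    (hspan : Submodule.span ℝ (Set.range (fun j => Nᵀ j)) = LinearMap.ker P.mulVecLin) :
    NegDef (Nᵀ * Ψ * N) ↔ ∀ x ∈ LinearMap.ker P.mulVecLin, x ≠ 0 → x ⬝ᵥ Ψ *ᵥ x < 0 := by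
  have hsymm : (Nᵀ * Ψ * N).IsSymm := by
    simp [Matrix.IsSymm, Matrix.transpose_mul, hΨ.eq, Matrix.mul_assoc]
  have hinj : Function.Injective N.mulVec := Matrix.mulVec_injective_iff.2 hli
  have hrange : LinearMap.range N.mulVecLin = LinearMap.ker P.mulVecLin :=
    (Matrix.range_mulVecLin N).trans hspan
  have hform : ∀ c, c ⬝ᵥ (Nᵀ * Ψ * N) *ᵥ c = (N *ᵥ c) ⬝ᵥ Ψ *ᵥ (N *ᵥ c) := fun c => by
    simp only [← Matrix.mulVec_mulVec, Matrix.dotProduct_mulVec, Matrix.vecMul_transpose]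
  rw [negDef_iff hsymm, ← hrange]
  constructor
  · rintro h _ ⟨c, rfl⟩ hc
    rw [Matrix.mulVecLin_apply] at hc ⊢
    rw [← hform]
    exact h c fun h0 => hc (by rw [h0, Matrix.mulVec_zero])
  · intro h c hc
    rw [hform]
    exact h _ ⟨c, rfl⟩ fun h0 => hc (hinj (h0.trans (Matrix.mulVec_zero N).symm))

theorem dotProduct_projection_mulVec {n p q : Type*} [Fintype n] [Fintype p] [Fintype q]
    (Ψ : Matrix n n ℝ) (P : Matrix p n ℝ) (Q : Matrix q n ℝ) (X : Matrix q p ℝ) (x : n → ℝ) :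
    x ⬝ᵥ (Ψ + Pᵀ * Xᵀ * Q + Qᵀ * X * P) *ᵥ x =
      x ⬝ᵥ Ψ *ᵥ x + 2 * ((Q *ᵥ x) ⬝ᵥ X *ᵥ (P *ᵥ x)) := by
  have h₁ : x ⬝ᵥ (Qᵀ * X * P) *ᵥ x = (Q *ᵥ x) ⬝ᵥ X *ᵥ (P *ᵥ x) := by
    simp only [← Matrix.mulVec_mulVec, Matrix.dotProduct_mulVec, Matrix.vecMul_transpose]
  have h₂ : x ⬝ᵥ (Pᵀ * Xᵀ * Q) *ᵥ x = (Q *ᵥ x) ⬝ᵥ X *ᵥ (P *ᵥ x) := by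
    rw [← h₁, ← Matrix.dotProduct_transpose_mulVec]
    simp [Matrix.transpose_mul, Matrix.mul_assoc]
  rw [Matrix.add_mulVec, Matrix.add_mulVec, dotProduct_add, dotProduct_add, h₁, h₂]
  ring

/-- **Projection lemma.**  Let `Ψ` be symmetric, and let `NP`, `NQ` be matrices whose
columns form bases of the null spaces of `P` and `Q` respectively.  There exists `X`
with `Ψ + PᵀXᵀQ + QᵀXP` negative definite iff `NPᵀ Ψ NP` and `NQᵀ Ψ NQ` are both
negative definite. -/
theorem projection_lemma (n p q rP rQ : ℕ)
    (Ψ : Matrix (Fin n) (Fin n) ℝ) (hΨ : Ψ.IsSymm)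
    (P : Matrix (Fin p) (Fin n) ℝ) (Q : Matrix (Fin q) (Fin n) ℝ)
    (NP : Matrix (Fin n) (Fin rP) ℝ) (NQ : Matrix (Fin n) (Fin rQ) ℝ)
    -- the columns of `NP` are linearly independent
    (hNPli : LinearIndependent ℝ (fun j => NPᵀ j))
    -- the columns of `NP` lie in the null space of `P`
    (hPNP : P * NP = 0)
    -- the columns of `NP` span the null space of `P`
    (hNPspan : Submodule.span ℝ (Set.range (fun j => NPᵀ j)) = LinearMap.ker P.mulVecLin)
    -- likewise for `NQ` and `Q`
    (hNQli : LinearIndependent ℝ (fun j => NQᵀ j))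
    (hQNQ : Q * NQ = 0)
    (hNQspan : Submodule.span ℝ (Set.range (fun j => NQᵀ j)) = LinearMap.ker Q.mulVecLin) :
    (∃ X : Matrix (Fin q) (Fin p) ℝ, NegDef (Ψ + Pᵀ * Xᵀ * Q + Qᵀ * X * P)) ↔
      (NegDef (NPᵀ * Ψ * NP) ∧ NegDef (NQᵀ * Ψ * NQ)) := by
  have hsymm : ∀ X : Matrix (Fin q) (Fin p) ℝ, (Ψ + Pᵀ * Xᵀ * Q + Qᵀ * X * P).IsSymm := fun X => by
    simp only [Matrix.IsSymm, Matrix.transpose_add, Matrix.transpose_mul,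
      Matrix.transpose_transpose, hΨ.eq, Matrix.mul_assoc]
    abel
  rw [negDef_compression_iff hΨ hNPli hNPspan, negDef_compression_iff hΨ hNQli hNQspan]
  simp only [negDef_iff (hsymm _), dotProduct_projection_mulVec]
  constructor
  · rintro ⟨X, hX⟩
    constructor <;> intro x hx hx0 <;> have h := hX x hx0 <;>
      rw [LinearMap.mem_ker, Matrix.mulVecLin_apply] at hx <;> simpa [hx] using h
  · rintro ⟨hP, hQ⟩
    have hB : (Matrix.toBilin' (-Ψ)).IsSymm := ⟨fun x y => by
      simp only [Matrix.toBilin'_apply']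
      rw [← Matrix.dotProduct_transpose_mulVec, Matrix.transpose_neg, hΨ.eq]⟩
    obtain ⟨a, b, G, ha, hb, hpos⟩ := exists_form_sub_two_mul_pos (Matrix.toBilin' (-Ψ))
      (Matrix.toBilin' 1) hB
      (fun x hx => by
        simpa [Matrix.toBilin'_apply'] using Matrix.dotProduct_star_self_pos_iff.2 hx)
      (LinearMap.ker P.mulVecLin) (LinearMap.ker Q.mulVecLin)
      (fun x hx h0 => by simpa [Matrix.toBilin'_apply', Matrix.neg_mulVec] using hP x hx h0)
      (fun x hx h0 => by simpa [Matrix.toBilin'_apply', Matrix.neg_mulVec] using hQ x hx h0)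
    obtain ⟨s, hs⟩ := Q.mulVecLin.exists_generalizedInverse
    obtain ⟨t, ht⟩ := P.mulVecLin.exists_generalizedInverse
    refine ⟨LinearMap.toMatrix₂' ℝ (G.compl₁₂ (a ∘ₗ s) (b ∘ₗ t)), fun x hx0 => ?_⟩
    have hX : (Q *ᵥ x) ⬝ᵥ LinearMap.toMatrix₂' ℝ (G.compl₁₂ (a ∘ₗ s) (b ∘ₗ t)) *ᵥ (P *ᵥ x)
        = G (a x) (b x) := by
      rw [← Matrix.toLinearMap₂'_apply', Matrix.toLinearMap₂'_toMatrix', LinearMap.compl₁₂_apply,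
        LinearMap.comp_apply, LinearMap.comp_apply, ← Matrix.mulVecLin_apply,
        ← Matrix.mulVecLin_apply, hs a ha, ht b hb]
    have h := hpos x hx0
    rw [Matrix.toBilin'_apply', Matrix.neg_mulVec, dotProduct_neg] at h
    rw [hX]
    linarith
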